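/- arXiv:1810.07432 — 4 statements merged into one kernel-verified Lean document; each statement's English description precedes it below -/
import Mathlib

section
/- Let B be a proper linear subspace of ℝ^d and ψ : [1,∞) → (0,∞) a decreasing function such that dist(z, B) ≥ ψ(|z|) for every nonzero z ∈ ℤ^d. For T ≥ 1 let Ω°_T = {w ∈ ℝ^d : |w| ≤ T, dist(w, B) < ψ(T)}. Then for every T ≥ 1 and every v ∈ ℝ^d, the set v + (1/2)Ω°_T contains at most one point of ℤ^d. -/
open MeasureTheory Filter

noncomputable section

/-- The sup-norm of a vector in Euclidean space. -/
def supNorm {d : ℕ} (w : EuclideanSpace ℝ (Fin d)) : ℝ := ⨆ i, |w i|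

/-- The point of `ℝ^d` (with Euclidean metric) corresponding to an integer vector. -/
def intVec {d : ℕ} (z : Fin d → ℤ) : EuclideanSpace ℝ (Fin d) :=
  (WithLp.equiv 2 (Fin d → ℝ)).symm (fun i => (z i : ℝ))

/-- The irrationality measure function `ψ_B` of a linear subspace of `ℝ^d`:
`ψ_B(t) = inf { dist(z, B) : z ∈ ℤ^d, 1 ≤ |z| < t }`. -/
def psiSub {d : ℕ} (B : Submodule ℝ (EuclideanSpace ℝ (Fin d))) (t : ℝ) : ℝ :=
  sInf ((fun z : Fin d → ℤ =>
      Metric.infDist (intVec z) (B : Set (EuclideanSpace ℝ (Fin d)))) ''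
    {z | 1 ≤ supNorm (intVec z) ∧ supNorm (intVec z) < t})

/-- The Diophantine exponent of a linear subspace of `ℝ^d`:
`ω(B) = sup { γ : liminf_{t→∞} t^γ ψ_B(t) < ∞ }`, as an extended real number. -/
def diophExp {d : ℕ} (B : Submodule ℝ (EuclideanSpace ℝ (Fin d))) : EReal :=
  sSup {x : EReal | ∃ γ : ℝ, x = (γ : EReal) ∧
    Filter.liminf (fun t : ℝ => ENNReal.ofReal (t ^ γ * psiSub B t)) Filter.atTop < ⊤}

/-- The graph subspace `C(Θ)` of an `(a-c)×c` matrix `Θ`, relative to an orthonormal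
basis `e` of an `a`-dimensional subspace of `ℝ^d`:
`C(Θ) = { ∑ x_j e_j + ∑_i (∑_j θ_{ij} x_j) e_{c+i} : x ∈ ℝ^c }`. -/
def graphSub (d a c : ℕ) (hca : c ≤ a) (e : Fin a → EuclideanSpace ℝ (Fin d))
    (Θ : Fin (a - c) → Fin c → ℝ) : Submodule ℝ (EuclideanSpace ℝ (Fin d)) :=
  Submodule.span ℝ {v | ∃ x : Fin c → ℝ,
    v = (∑ j : Fin c, x j • e (Fin.castLE hca j)) +
        ∑ i : Fin (a - c), (∑ j : Fin c, Θ i j * x j) • e ⟨c + i.1, by have := i.2; omega⟩}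

theorem abs_le_supNorm {d : ℕ} (w : EuclideanSpace ℝ (Fin d)) (i : Fin d) :
    |w i| ≤ supNorm w :=
  le_ciSup (f := fun i => |w i|) (Set.finite_range _).bddAbove i

theorem one_le_supNorm_intVec {d : ℕ} {z : Fin d → ℤ} (hz : z ≠ 0) :
    1 ≤ supNorm (intVec z) := by
  obtain ⟨i, hi⟩ := Function.ne_iff.mp hz
  refine le_trans ?_ (abs_le_supNorm (intVec z) i)
  change (1 : ℝ) ≤ |(z i : ℝ)|
  exact_mod_cast Int.one_le_abs hi

theorem intVec_sub {d : ℕ} (y z : Fin d → ℤ) : intVec (y - z) = intVec y - intVec z := by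
  ext i
  simp [intVec]

theorem supNorm_half_smul_sub_le {d : ℕ} {u w : EuclideanSpace ℝ (Fin d)} {T : ℝ}
    (hT : 0 ≤ T) (hu : supNorm u ≤ T) (hw : supNorm w ≤ T) :
    supNorm ((2⁻¹ : ℝ) • (u - w)) ≤ T := by
  refine Real.iSup_le (fun i => ?_) hT
  have h₁ := abs_le.mp ((abs_le_supNorm u i).trans hu)
  have h₂ := abs_le.mp ((abs_le_supNorm w i).trans hw)
  simp only [PiLp.smul_apply, PiLp.sub_apply, smul_eq_mul]
  rw [abs_le]
  constructor <;> linarith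

theorem infDist_half_smul_sub_lt {E : Type*} [NormedAddCommGroup E] [NormedSpace ℝ E]
    (B : Submodule ℝ E) {u w : E} {r : ℝ} (hu : Metric.infDist u (B : Set E) < r)
    (hw : Metric.infDist w (B : Set E) < r) :
    Metric.infDist ((2⁻¹ : ℝ) • (u - w)) (B : Set E) < r := by
  obtain ⟨b, hb, hub⟩ := (Metric.infDist_lt_iff ⟨0, B.zero_mem⟩).mp hu
  obtain ⟨c, hc, hwc⟩ := (Metric.infDist_lt_iff ⟨0, B.zero_mem⟩).mp hw
  refine (Metric.infDist_le_dist_of_mem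
    (B.smul_mem (2⁻¹ : ℝ) (B.sub_mem hb hc))).trans_lt ?_
  have h := dist_sub_sub_le u w b c
  rw [dist_smul₀, Real.norm_of_nonneg (by norm_num)]
  linarith

/-- Lemma 2 of the paper: if `B` is a proper `ψ`-badly approximable subspace of
`ℝ^d`, then for every `T ≥ 1` and every `v ∈ ℝ^d` the set `v + (1/2)Ω°_T`, where
`Ω°_T = {w : |w| ≤ T, dist(w,B) < ψ(T)}`, contains at most one integer point. -/
theorem stmt_5 (d : ℕ) (B : Submodule ℝ (EuclideanSpace ℝ (Fin d))) (hB : B ≠ ⊤)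
    (ψ : ℝ → ℝ) (hψpos : ∀ T : ℝ, 1 ≤ T → 0 < ψ T) (hψanti : AntitoneOn ψ (Set.Ici 1))
    (hbad : ∀ z : Fin d → ℤ, z ≠ 0 →
      ψ (supNorm (intVec z)) ≤ Metric.infDist (intVec z) (B : Set (EuclideanSpace ℝ (Fin d)))) :
    ∀ T : ℝ, 1 ≤ T → ∀ v : EuclideanSpace ℝ (Fin d),
      Set.Subsingleton {z : Fin d → ℤ |
        intVec z ∈ (fun w => v + (2⁻¹ : ℝ) • w) ''
          {w : EuclideanSpace ℝ (Fin d) | supNorm w ≤ T ∧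
            Metric.infDist w (B : Set (EuclideanSpace ℝ (Fin d))) < ψ T}} := by
  rintro T hT v y ⟨u, ⟨huT, huB⟩, hy⟩ z ⟨w, ⟨hwT, hwB⟩, hz⟩
  by_contra hne
  have hyz : y - z ≠ 0 := sub_ne_zero.mpr hne
  have hdiff : intVec (y - z) = (2⁻¹ : ℝ) • (u - w) := by
    rw [intVec_sub, ← hy, ← hz, smul_sub]
    exact add_sub_add_left_eq_sub _ _ _
  have hle : supNorm (intVec (y - z)) ≤ T :=
    hdiff ▸ supNorm_half_smul_sub_le (zero_le_one.trans hT) huT hwT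
  have hlt := infDist_half_smul_sub_lt B huB hwB
  rw [← hdiff] at hlt
  exact (((hψanti (one_le_supNorm_intVec hyz) hT hle).trans (hbad _ hyz)).trans_lt hlt).false

end
end

section
/- Let 1 ≤ c < a be integers and R > 1. There exists a constant κ > 0 depending only on a, c and R such that for every z* = (z*_1, …, z*_a) ∈ ℝ^a \ {0} and every ε with 0 < ε ≤ max_{1 ≤ j ≤ c} |z*_j|, the Lebesgue measure of the set {Θ = (θ_{ij}) ∈ ℝ^{(a−c)×c} : max_{i,j} |θ_{ij}| ≤ R and |Σ_{j=1}^c θ_{ij} z*_j − z*_{c+i}| < √(c+1)·R·ε for all i = 1, …, a−c} is at most κ · ε^{a−c} / |z*|^{a−c}, where |z*| = max_{1 ≤ k ≤ a} |z*_k|. -/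
open MeasureTheory Filter

noncomputable section

/-- The part of the box `[-R, R]^ι` within an affine slab has volume at most
`(2R)^(|ι|-1) · 2δ / |w j₀|`, for any coordinate `w j₀ ≠ 0` of the normal vector of the slab. -/
theorem volume_box_inter_slab_le {ι : Type*} [Fintype ι] (w : ι → ℝ) (j₀ : ι)
    (hw : w j₀ ≠ 0) (R v δ : ℝ) (hR : 0 ≤ R) (hδ : 0 ≤ δ) :
    volume {θ : ι → ℝ | (∀ j, |θ j| ≤ R) ∧ |(∑ j, θ j * w j) - v| < δ} ≤
      ENNReal.ofReal ((2 * R) ^ (Fintype.card ι - 1) * (2 * δ) / |w j₀|) := by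
  classical
  set A : Matrix ι ι ℝ := Matrix.updateRow 1 j₀ w with hA
  have hdet : LinearMap.det (Matrix.toLin' A) = w j₀ := by
    rw [LinearMap.det_toLin', hA, ← Matrix.cramer_transpose_apply, Matrix.transpose_one,
      Matrix.cramer_one]
    simp
  set B : ι → Set ℝ := fun j => if j = j₀ then Metric.ball v δ else Metric.closedBall 0 R with hB
  have hsub : {θ : ι → ℝ | (∀ j, |θ j| ≤ R) ∧ |(∑ j, θ j * w j) - v| < δ} ⊆
      Matrix.toLin' A ⁻¹' Set.pi Set.univ B := by
    rintro θ ⟨h₁, h₂⟩ j -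
    by_cases hj : j = j₀
    · subst hj
      simpa [hB, hA, Matrix.mulVec, dotProduct, Real.dist_eq, mul_comm] using h₂
    · simpa [hB, hA, hj, Matrix.mulVec, dotProduct, Matrix.updateRow_ne, Matrix.one_apply]
        using h₁ j
  refine (measure_mono hsub).trans ?_
  rw [Measure.addHaar_preimage_linearMap _ (by rw [hdet]; exact hw), hdet, volume_pi_pi,
    ← Finset.mul_prod_erase _ _ (Finset.mem_univ j₀)]
  have hprod : ∏ j ∈ Finset.univ.erase j₀, volume (B j) =
      ENNReal.ofReal (2 * R) ^ (Fintype.card ι - 1) := by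
    rw [Finset.prod_congr rfl (g := fun _ => ENNReal.ofReal (2 * R)), Finset.prod_const,
      Finset.card_erase_of_mem (Finset.mem_univ _), Finset.card_univ]
    intro j hj
    simp [hB, Finset.ne_of_mem_erase hj]
  have hj₀ : volume (B j₀) = ENNReal.ofReal (2 * δ) := by simp [hB]
  rw [hprod, hj₀, ← ENNReal.ofReal_pow (by positivity), ← ENNReal.ofReal_mul (by positivity),
    ← ENNReal.ofReal_mul (by positivity), abs_inv]
  apply le_of_eq
  congr 1
  ring

/-- measure estimate for the sets `L̂_{z*}`: for `1 ≤ c < a` and `R > 1` there is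
`κ > 0` (depending only on `a`, `c`, `R`) such that for every nonzero `z* ∈ ℝ^a` and every
`0 < ε ≤ max_{1≤j≤c} |z*_j|`, the Lebesgue measure of the set of matrices
`Θ ∈ ℝ^{(a−c)×c}` with `max |θ_{ij}| ≤ R` and `|Σ_j θ_{ij} z*_j − z*_{c+i}| < √(c+1)·R·ε`
for all `i` is at most `κ ε^{a−c} / |z*|^{a−c}`. -/
theorem stmt_6 (a c : ℕ) (hc : 1 ≤ c) (hca : c < a) (R : ℝ) (hR : 1 < R) :
    ∃ κ : ℝ, 0 < κ ∧
      ∀ zs : Fin a → ℝ, zs ≠ 0 →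
        ∀ ε : ℝ, 0 < ε → ε ≤ ⨆ j : Fin c, |zs (Fin.castLE hca.le j)| →
          volume {Θ : Fin (a - c) → Fin c → ℝ |
              (∀ i j, |Θ i j| ≤ R) ∧
              ∀ i : Fin (a - c),
                |(∑ j : Fin c, Θ i j * zs (Fin.castLE hca.le j)) -
                    zs ⟨c + i.1, by have := i.2; omega⟩| <
                  Real.sqrt ((c : ℝ) + 1) * R * ε} ≤
            ENNReal.ofReal (κ * ε ^ (a - c) / (⨆ k : Fin a, |zs k|) ^ (a - c)) := by
  set S : ℝ := Real.sqrt ((c : ℝ) + 1) * R with hS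
  have hR0 : 0 < R := by linarith
  have hSpos : 0 < S := by positivity
  set K : ℝ := c * R + S + 1 with hK
  have hKpos : 0 < K := by positivity
  refine ⟨((2 * R) ^ (c - 1) * (2 * S) * K) ^ (a - c), by positivity, ?_⟩
  intro zs hzs ε hε hεM
  set w : Fin c → ℝ := fun j => zs (Fin.castLE hca.le j) with hw
  have : Nonempty (Fin c) := ⟨⟨0, hc⟩⟩
  have : Nonempty (Fin a) := ⟨⟨0, by omega⟩⟩
  obtain ⟨j₀, hj₀⟩ := exists_eq_ciSup_of_finite (f := fun j => |w j|)
  have hwle : ∀ j, |w j| ≤ |w j₀| := fun j => by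
    rw [hj₀]
    exact le_ciSup (f := fun j => |w j|) (Set.finite_range _).bddAbove j
  rw [show (⨆ j : Fin c, |zs (Fin.castLE hca.le j)|) = |w j₀| from hj₀.symm] at hεM
  have hMpos : 0 < |w j₀| := hε.trans_le hεM
  set N : ℝ := ⨆ k : Fin a, |zs k| with hN
  have hNpos : 0 < N := hMpos.trans_le
    (le_ciSup (f := fun k => |zs k|) (Set.finite_range _).bddAbove (Fin.castLE hca.le j₀))
  rcases Set.eq_empty_or_nonempty {Θ : Fin (a - c) → Fin c → ℝ |
      (∀ i j, |Θ i j| ≤ R) ∧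
      ∀ i : Fin (a - c), |(∑ j : Fin c, Θ i j * w j) -
        zs ⟨c + i.1, by have := i.2; omega⟩| < S * ε} with hE | ⟨Θ, hΘR, hΘ⟩
  · rw [hE, measure_empty]
    exact zero_le
  have hNK : N ≤ K * |w j₀| := by
    refine ciSup_le fun k => ?_
    by_cases hk : k.1 < c
    · have h₁ : |zs k| ≤ |w j₀| := hwle ⟨k.1, hk⟩
      have h₂ : 0 ≤ (c * R + S) * |w j₀| := by positivity
      rw [hK]
      linarith
    · have hi := hΘ ⟨k.1 - c, by have := k.2; omega⟩
      have hik : (⟨c + (k.1 - c), by have := k.2; omega⟩ : Fin a) = k := Fin.ext (by simp; omega)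
      simp only [hik] at hi
      have hsum : |∑ j : Fin c, Θ ⟨k.1 - c, by have := k.2; omega⟩ j * w j| ≤ c * R * |w j₀| := by
        refine (Finset.abs_sum_le_sum_abs _ _).trans ?_
        refine (Finset.sum_le_card_nsmul _ _ (R * |w j₀|) fun j _ => ?_).trans ?_
        · rw [abs_mul]
          exact mul_le_mul (hΘR _ j) (hwle j) (abs_nonneg _) hR0.le
        · simp [mul_assoc]
      have h₁ : S * ε ≤ S * |w j₀| := mul_le_mul_of_nonneg_left hεM hSpos.le
      have h₂ := abs_sub_abs_le_abs_sub (zs k)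
        (∑ j : Fin c, Θ ⟨k.1 - c, by have := k.2; omega⟩ j * w j)
      rw [abs_sub_comm] at h₂
      rw [hK]
      linarith
  have hsub : {Θ : Fin (a - c) → Fin c → ℝ |
      (∀ i j, |Θ i j| ≤ R) ∧
      ∀ i : Fin (a - c), |(∑ j : Fin c, Θ i j * w j) -
        zs ⟨c + i.1, by have := i.2; omega⟩| < S * ε} ⊆
      Set.pi Set.univ fun i : Fin (a - c) => {θ : Fin c → ℝ | (∀ j, |θ j| ≤ R) ∧
        |(∑ j, θ j * w j) - zs ⟨c + i.1, by have := i.2; omega⟩| < S * ε} :=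
    fun Θ h i _ => ⟨h.1 i, h.2 i⟩
  refine (measure_mono hsub).trans ?_
  rw [volume_pi_pi]
  refine (Finset.prod_le_pow_card _ _ _ fun i _ => volume_box_inter_slab_le w j₀
    (abs_pos.mp hMpos) R _ (S * ε) hR0.le (by positivity)).trans ?_
  rw [Finset.card_univ, Fintype.card_fin, Fintype.card_fin, ← ENNReal.ofReal_pow (by positivity)]
  apply ENNReal.ofReal_le_ofReal
  rw [← mul_pow, ← div_pow]
  refine pow_le_pow_left₀ (by positivity) ?_ _
  rw [div_le_div_iff₀ hMpos hNpos]
  calc (2 * R) ^ (c - 1) * (2 * (S * ε)) * N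
      ≤ (2 * R) ^ (c - 1) * (2 * (S * ε)) * (K * |w j₀|) := by gcongr
    _ = (2 * R) ^ (c - 1) * (2 * S) * K * ε * |w j₀| := by ring

end
end

section
/- Let Θ be a real n×m matrix and L_Θ = {(x, Θx) : x ∈ ℝ^m} ⊂ ℝ^{m+n}. Then there exist positive constants κ₁, κ₂, κ₃, κ₄ depending on Θ such that κ₁·ψ_Θ(κ₂ t) ≤ ψ_{L_Θ}(t) ≤ κ₃·ψ_Θ(κ₄ t) for all sufficiently large t. -/
open MeasureTheory Filter

noncomputable section

/-- Distance from a real number to the nearest integer. -/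
def distToInt (ξ : ℝ) : ℝ := |ξ - round ξ|

/-- The irrationality measure function `ψ_Θ` of an `n×m` real matrix `Θ`:
`ψ_Θ(t) = min { max_j ‖Σ_i θ_{ji} x_i‖ : x ∈ ℤ^m, 0 < |x| ≤ t }`. -/
def psiMat {m n : ℕ} (Θ : Fin n → Fin m → ℝ) (t : ℝ) : ℝ :=
  sInf ((fun x : Fin m → ℤ =>
      ⨆ j : Fin n, distToInt (∑ i : Fin m, Θ j i * (x i : ℝ))) ''
    {x | x ≠ 0 ∧ (⨆ i : Fin m, |(x i : ℝ)|) ≤ t})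

/-- The graph subspace `L_Θ = {(x, Θx) : x ∈ ℝ^m} ⊆ ℝ^{m+n}` of an `n×m` matrix `Θ`. -/
def matGraph {m n : ℕ} (Θ : Fin n → Fin m → ℝ) :
    Submodule ℝ (EuclideanSpace ℝ (Fin (m + n))) :=
  Submodule.span ℝ {w | ∃ x : Fin m → ℝ,
    w = (WithLp.equiv 2 (Fin (m + n) → ℝ)).symm
      (fun k => Fin.addCases (fun i => x i) (fun j => ∑ i : Fin m, Θ j i * x i) k)}

/-- The sum of the absolute values of the entries of a real matrix. -/
def entrySum {m n : ℕ} (Θ : Fin n → Fin m → ℝ) : ℝ := ∑ j, ∑ i, |Θ j i|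

lemma entrySum_nonneg {m n : ℕ} (Θ : Fin n → Fin m → ℝ) : 0 ≤ entrySum Θ :=
  Finset.sum_nonneg fun _ _ => Finset.sum_nonneg fun _ _ => abs_nonneg _

lemma abs_sum_mul_le_entrySum {m n : ℕ} (Θ : Fin n → Fin m → ℝ) (j : Fin n)
    {v : Fin m → ℝ} {M : ℝ} (hM : 0 ≤ M) (hv : ∀ i, |v i| ≤ M) :
    |∑ i, Θ j i * v i| ≤ entrySum Θ * M := by
  calc |∑ i, Θ j i * v i| ≤ ∑ i, |Θ j i * v i| := Finset.abs_sum_le_sum_abs _ _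
    _ ≤ ∑ i, |Θ j i| * M := Finset.sum_le_sum fun i _ => by
        rw [abs_mul]; exact mul_le_mul_of_nonneg_left (hv i) (abs_nonneg _)
    _ = (∑ i, |Θ j i|) * M := by rw [Finset.sum_mul]
    _ ≤ entrySum Θ * M := by
        refine mul_le_mul_of_nonneg_right ?_ hM
        exact Finset.single_le_sum (f := fun j => ∑ i, |Θ j i|)
          (fun _ _ => Finset.sum_nonneg fun _ _ => abs_nonneg _) (Finset.mem_univ j)

lemma apply_natAdd_of_mem_matGraph {m n : ℕ} (Θ : Fin n → Fin m → ℝ)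
    {w : EuclideanSpace ℝ (Fin (m + n))} (hw : w ∈ matGraph Θ) (j : Fin n) :
    w (Fin.natAdd m j) = ∑ i, Θ j i * w (Fin.castAdd n i) := by
  induction hw using Submodule.span_induction with
  | mem w h =>
    obtain ⟨x, rfl⟩ := h
    simp
  | zero => simp
  | add u v _ _ hu hv => simp [hu, hv, mul_add, Finset.sum_add_distrib]
  | smul a u _ hu =>
    simp only [PiLp.smul_apply, smul_eq_mul, hu, Finset.mul_sum]
    exact Finset.sum_congr rfl fun i _ => by ring

lemma norm_le_mul_of_abs_apply_le {d : ℕ} {w : EuclideanSpace ℝ (Fin d)} {M : ℝ}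
    (hM : 0 ≤ M) (hw : ∀ k, |w k| ≤ M) : ‖w‖ ≤ d * M := by
  have h : ‖w‖ ^ 2 ≤ (d * M) ^ 2 := by
    rw [EuclideanSpace.norm_sq_eq]
    calc ∑ k, ‖w k‖ ^ 2 ≤ ∑ _k : Fin d, M ^ 2 := Finset.sum_le_sum fun k _ =>
          pow_le_pow_left₀ (norm_nonneg _) (hw k) 2
      _ = d * M ^ 2 := by simp
      _ ≤ (d * M) ^ 2 := by
          rw [mul_pow]
          refine mul_le_mul_of_nonneg_right ?_ (sq_nonneg M)
          exact_mod_cast Nat.le_self_pow two_ne_zero d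
  exact le_of_sq_le_sq h (by positivity)

lemma abs_apply_le_supNorm {d : ℕ} (w : EuclideanSpace ℝ (Fin d)) (k : Fin d) :
    |w k| ≤ supNorm w :=
  le_ciSup (f := fun i => |w i|) (Set.finite_range _).bddAbove k

lemma distToInt_le_abs_sub (ξ : ℝ) (k : ℤ) : distToInt ξ ≤ |ξ - k| := round_le ξ k

lemma psiMat_le {m n : ℕ} (Θ : Fin n → Fin m → ℝ) {t : ℝ} {x : Fin m → ℤ} (hx : x ≠ 0)
    (hxt : (⨆ i : Fin m, |(x i : ℝ)|) ≤ t) :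
    psiMat Θ t ≤ ⨆ j : Fin n, distToInt (∑ i : Fin m, Θ j i * (x i : ℝ)) := by
  refine csInf_le ⟨0, ?_⟩ ⟨x, ⟨hx, hxt⟩, rfl⟩
  rintro _ ⟨y, -, rfl⟩
  exact Real.iSup_nonneg fun _ => abs_nonneg _

lemma exists_ne_zero_iSup_abs_le_one {m : ℕ} (hm : 1 ≤ m) :
    ∃ x : Fin m → ℤ, x ≠ 0 ∧ (⨆ i : Fin m, |(x i : ℝ)|) ≤ 1 := by
  refine ⟨fun _ => 1, fun h => ?_, ?_⟩
  · exact one_ne_zero (congrFun h ⟨0, hm⟩)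
  · exact Real.iSup_le (fun i => by simp) zero_le_one

lemma psiMat_le_half {m n : ℕ} (hm : 1 ≤ m) (Θ : Fin n → Fin m → ℝ) {t : ℝ} (ht : 1 ≤ t) :
    psiMat Θ t ≤ 1 / 2 := by
  obtain ⟨x, hx, hx1⟩ := exists_ne_zero_iSup_abs_le_one hm
  exact (psiMat_le Θ hx (hx1.trans ht)).trans
    (Real.iSup_le (fun j => abs_sub_round _) (by norm_num))

/-- An integer point whose horizontal part is at most `t` lies at distance at least a constant
times `ψ_Θ(t)` from every point of the graph. -/
lemma psiMat_le_mul_dist {m n : ℕ} (hm : 1 ≤ m) (Θ : Fin n → Fin m → ℝ) {t : ℝ} (ht : 1 ≤ t)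
    {z : Fin (m + n) → ℤ} (hz : z ≠ 0) (hzt : supNorm (intVec z) ≤ t)
    {w : EuclideanSpace ℝ (Fin (m + n))} (hw : w ∈ matGraph Θ) :
    psiMat Θ t ≤ (1 + entrySum Θ) * dist (intVec z) w := by
  have hcoord : ∀ k, |(z k : ℝ) - w k| ≤ dist (intVec z) w := fun k => by
    rw [dist_eq_norm]
    exact PiLp.norm_apply_le (intVec z - w) k
  have hdiff : ∀ j : Fin n, |∑ i, Θ j i * (z (Fin.castAdd n i) : ℝ) - z (Fin.natAdd m j)| ≤
      (1 + entrySum Θ) * dist (intVec z) w := fun j => by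
    have h1 := hcoord (Fin.natAdd m j)
    have h2 := abs_sum_mul_le_entrySum Θ j dist_nonneg fun i => hcoord (Fin.castAdd n i)
    rw [apply_natAdd_of_mem_matGraph Θ hw j] at h1
    simp only [mul_sub, Finset.sum_sub_distrib] at h2
    rw [abs_le] at h1 h2 ⊢
    constructor <;> linarith [h1.1, h1.2, h2.1, h2.2]
  have hnonneg : 0 ≤ (1 + entrySum Θ) * dist (intVec z) w :=
    mul_nonneg (by linarith [entrySum_nonneg Θ]) dist_nonneg
  by_cases hx : (fun i : Fin m => z (Fin.castAdd n i)) = 0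
  · obtain ⟨j, hj⟩ : ∃ j : Fin n, z (Fin.natAdd m j) ≠ 0 := by
      by_contra! h
      refine hz (funext fun k => ?_)
      induction k using Fin.addCases with
      | left i => exact congrFun hx i
      | right j => exact h j
    have h1 : (1 : ℝ) ≤ |(z (Fin.natAdd m j) : ℝ)| := by
      exact_mod_cast Int.one_le_abs hj
    have h2 := hdiff j
    have h3 : ∀ i, z (Fin.castAdd n i) = 0 := congrFun hx
    simp only [h3, Int.cast_zero, mul_zero, Finset.sum_const_zero, zero_sub, abs_neg] at h2
    linarith [psiMat_le_half hm Θ ht]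
  · refine (psiMat_le Θ hx (Real.iSup_le (fun i => ?_) (by linarith))).trans
      (Real.iSup_le (fun j => ?_) hnonneg)
    · exact (abs_apply_le_supNorm (intVec z) _).trans hzt
    · exact (distToInt_le_abs_sub _ _).trans (hdiff j)

lemma exists_one_le_supNorm_intVec_lt {d : ℕ} (hd : 1 ≤ d) {t : ℝ} (ht : 1 < t) :
    ∃ z : Fin d → ℤ, 1 ≤ supNorm (intVec z) ∧ supNorm (intVec z) < t := by
  refine ⟨fun _ => 1, ?_, ?_⟩
  · simpa [intVec] using abs_apply_le_supNorm (intVec fun _ : Fin d => (1 : ℤ)) ⟨0, hd⟩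
  · exact (Real.iSup_le (fun i => by simp [intVec]) zero_le_one).trans_lt ht

lemma psiMat_le_mul_psiSub {m n : ℕ} (hm : 1 ≤ m) (Θ : Fin n → Fin m → ℝ) {t : ℝ}
    (ht : 1 < t) : (1 + entrySum Θ)⁻¹ * psiMat Θ t ≤ psiSub (matGraph Θ) t := by
  have hC : 0 < 1 + entrySum Θ := by linarith [entrySum_nonneg Θ]
  obtain ⟨z₀, hz₀⟩ := exists_one_le_supNorm_intVec_lt (d := m + n) (by omega) ht
  refine le_csInf ⟨_, z₀, hz₀, rfl⟩ ?_
  rintro _ ⟨z, ⟨hz1, hzt⟩, rfl⟩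
  refine (Metric.le_infDist ⟨0, (matGraph Θ).zero_mem⟩).2 fun w hw => ?_
  rw [inv_mul_le_iff₀ hC]
  refine psiMat_le_mul_dist hm Θ ht.le ?_ hzt.le hw
  rintro rfl
  have : supNorm (intVec (0 : Fin (m + n) → ℤ)) ≤ 0 :=
    Real.iSup_le (fun i => by simp [intVec]) le_rfl
  linarith

/-- The distance from the nearest integer point above `x` to the graph, which bounds `ψ_{L_Θ}`. -/
lemma psiSub_le_mul_iSup_distToInt {m n : ℕ} (Θ : Fin n → Fin m → ℝ) {s t : ℝ} (hs : 0 ≤ s)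
    (hst : (1 + entrySum Θ) * s + 1 / 2 < t) {x : Fin m → ℤ} (hx : x ≠ 0)
    (hxs : (⨆ i : Fin m, |(x i : ℝ)|) ≤ s) :
    psiSub (matGraph Θ) t ≤
      ((m + n : ℕ) : ℝ) * ⨆ j : Fin n, distToInt (∑ i : Fin m, Θ j i * (x i : ℝ)) := by
  have hxi : ∀ i, |(x i : ℝ)| ≤ s := fun i =>
    (le_ciSup (f := fun i => |(x i : ℝ)|) (Set.finite_range _).bddAbove i).trans hxs
  have hC := entrySum_nonneg Θ
  have hCs := mul_nonneg hC hs
  let z : Fin (m + n) → ℤ :=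
    Fin.addCases (fun i => x i) (fun j => round (∑ i : Fin m, Θ j i * (x i : ℝ)))
  have hzl : ∀ i, z (Fin.castAdd n i) = x i := fun i => Fin.addCases_left i
  have hzr : ∀ j, z (Fin.natAdd m j) = round (∑ i : Fin m, Θ j i * (x i : ℝ)) :=
    fun j => Fin.addCases_right j
  have hz1 : 1 ≤ supNorm (intVec z) := by
    obtain ⟨i, hi⟩ := Function.ne_iff.1 hx
    have h1 : (1 : ℝ) ≤ |(z (Fin.castAdd n i) : ℝ)| := by
      rw [hzl]
      exact_mod_cast Int.one_le_abs hi
    exact h1.trans (abs_apply_le_supNorm (intVec z) (Fin.castAdd n i))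
  have hzt : supNorm (intVec z) < t := by
    refine (Real.iSup_le (fun k => ?_) (by linarith)).trans_lt hst
    change |(z k : ℝ)| ≤ _
    induction k using Fin.addCases with
    | left i => rw [hzl]; linarith [hxi i]
    | right j =>
      rw [hzr]
      have h1 := abs_sum_mul_le_entrySum Θ j hs hxi
      have h2 := abs_sub_round (∑ i : Fin m, Θ j i * (x i : ℝ))
      rw [abs_le] at h1 h2 ⊢
      constructor <;> linarith [h1.1, h1.2, h2.1, h2.2]
  let w : EuclideanSpace ℝ (Fin (m + n)) := (WithLp.equiv 2 (Fin (m + n) → ℝ)).symm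
    (fun k => Fin.addCases (fun i => (x i : ℝ)) (fun j => ∑ i : Fin m, Θ j i * (x i : ℝ)) k)
  have hw : w ∈ matGraph Θ := Submodule.subset_span ⟨fun i => (x i : ℝ), rfl⟩
  have hS : 0 ≤ ⨆ j : Fin n, distToInt (∑ i : Fin m, Θ j i * (x i : ℝ)) :=
    Real.iSup_nonneg fun _ => abs_nonneg _
  have hle : psiSub (matGraph Θ) t ≤ Metric.infDist (intVec z) (matGraph Θ) := by
    refine csInf_le ⟨0, ?_⟩ ⟨z, ⟨hz1, hzt⟩, rfl⟩
    rintro _ ⟨y, -, rfl⟩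
    exact Metric.infDist_nonneg
  refine hle.trans ((Metric.infDist_le_dist_of_mem hw).trans ?_)
  rw [dist_eq_norm]
  refine norm_le_mul_of_abs_apply_le hS fun k => ?_
  change |(z k : ℝ) - w k| ≤ _
  induction k using Fin.addCases with
  | left i => simpa [hzl, w] using hS
  | right j =>
    rw [hzr, abs_sub_comm]
    simp only [w, WithLp.equiv_symm_apply, Fin.addCases_right]
    exact le_ciSup (f := fun j => distToInt (∑ i : Fin m, Θ j i * (x i : ℝ)))
      (Set.finite_range _).bddAbove j

lemma psiSub_le_mul_psiMat {m n : ℕ} (hm : 1 ≤ m) (Θ : Fin n → Fin m → ℝ) {s t : ℝ}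
    (hs : 1 ≤ s) (hst : (1 + entrySum Θ) * s + 1 / 2 < t) :
    psiSub (matGraph Θ) t ≤ ((m + n : ℕ) : ℝ) * psiMat Θ s := by
  have hmn : (0 : ℝ) < ((m + n : ℕ) : ℝ) := by exact_mod_cast (by omega : 0 < m + n)
  obtain ⟨x₀, hx₀, hx₀s⟩ := exists_ne_zero_iSup_abs_le_one hm
  rw [← inv_mul_le_iff₀ hmn]
  refine le_csInf ⟨_, x₀, ⟨hx₀, hx₀s.trans hs⟩, rfl⟩ ?_
  rintro _ ⟨x, ⟨hx, hxs⟩, rfl⟩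
  rw [inv_mul_le_iff₀ hmn]
  exact psiSub_le_mul_iSup_distToInt Θ (by linarith) hst hx hxs

/-- for a real `n×m` matrix `Θ` and its graph `L_Θ ⊆ ℝ^{m+n}`, there are positive
constants `κ₁, κ₂, κ₃, κ₄` (depending on `Θ`) with
`κ₁ ψ_Θ(κ₂ t) ≤ ψ_{L_Θ}(t) ≤ κ₃ ψ_Θ(κ₄ t)` for all sufficiently large `t`. -/
theorem stmt_7 (m n : ℕ) (hm : 1 ≤ m) (hn : 1 ≤ n) (Θ : Fin n → Fin m → ℝ) :
    ∃ κ₁ κ₂ κ₃ κ₄ : ℝ, 0 < κ₁ ∧ 0 < κ₂ ∧ 0 < κ₃ ∧ 0 < κ₄ ∧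
      ∀ᶠ t : ℝ in atTop,
        κ₁ * psiMat Θ (κ₂ * t) ≤ psiSub (matGraph Θ) t ∧
        psiSub (matGraph Θ) t ≤ κ₃ * psiMat Θ (κ₄ * t) := by
  have hC : 0 < 1 + entrySum Θ := by linarith [entrySum_nonneg Θ]
  have hmn : (0 : ℝ) < ((m + n : ℕ) : ℝ) := by exact_mod_cast (by omega : 0 < m + n)
  refine ⟨(1 + entrySum Θ)⁻¹, 1, ((m + n : ℕ) : ℝ), (2 * (1 + entrySum Θ))⁻¹,
    by positivity, one_pos, hmn, by positivity, ?_⟩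
  filter_upwards [eventually_gt_atTop 1, eventually_ge_atTop (2 * (1 + entrySum Θ))]
    with t ht1 ht2
  refine ⟨by simpa using psiMat_le_mul_psiSub hm Θ ht1, psiSub_le_mul_psiMat hm Θ ?_ ?_⟩
  · rw [inv_mul_eq_div, one_le_div (by positivity)]
    exact ht2
  · have h : (1 + entrySum Θ) * ((2 * (1 + entrySum Θ))⁻¹ * t) = t / 2 := by
      field_simp
    rw [h]
    linarith

end
end

section
/- Let 1 ≤ c < b ≤ a < d be integers and β, γ, B₀, C₀ real numbers with 0 < γ < β. Define ψ(T) = T^{−β}(log(T+2))^{B₀} and φ(T) = T^{−γ}(log(T+2))^{C₀} for T ≥ 1, and define μ_T, M_T, λ_T as in the context. If either γ(d−c) > β(d−b) + c − b, or γ(d−c) = β(d−b) + c − b and C₀(d−c) − B₀(d−b) < −1, then the series Σ_{T=1}^∞ λ_T · φ(T)^{a−c}/T^{a−c} converges. -/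
open MeasureTheory Filter

noncomputable section

/-- `μ_T = (T/ψ(T))^{a−b} · max{1, (φ(T)/ψ(T))^{d−a}}` for `T ≥ 1`, and `μ_T = 0` for `T < 1`. -/
def muF (a b d : ℕ) (ψ φ : ℝ → ℝ) (T : ℝ) : ℝ :=
  if T < 1 then 0 else (T / ψ T) ^ (a - b) * max 1 ((φ T / ψ T) ^ (d - a))

/-- `M_T = Σ_{j=0}^{⌊log₂ T⌋} μ_{T/2^j}` for integers `T ≥ 1` (and `M_0 = 0`). -/
def MF (a b d : ℕ) (ψ φ : ℝ → ℝ) (T : ℕ) : ℝ :=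
  ∑ j ∈ Finset.range (Nat.log 2 T + 1), muF a b d ψ φ ((T : ℝ) / 2 ^ j)

/-- `λ_T = M_T − M_{T−1}` for integers `T ≥ 1`. -/
def lamF (a b d : ℕ) (ψ φ : ℝ → ℝ) (T : ℕ) : ℝ :=
  MF a b d ψ φ T - MF a b d ψ φ (T - 1)

/-- The function `x ↦ x ^ r * log (x + 2) ^ s`. -/
def powLog (r s x : ℝ) : ℝ := x ^ r * Real.log (x + 2) ^ s

lemma one_le_log_add_two {x : ℝ} (hx : 1 ≤ x) : 1 ≤ Real.log (x + 2) := by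
  rw [Real.le_log_iff_exp_le (by linarith)]
  linarith [Real.exp_one_lt_d9]

lemma powLog_pos (r s : ℝ) {x : ℝ} (hx : 1 ≤ x) : 0 < powLog r s x := by
  have := one_le_log_add_two hx
  have : 0 < x := by linarith
  unfold powLog
  positivity

lemma powLog_mul (r s r' s' : ℝ) {x : ℝ} (hx : 1 ≤ x) :
    powLog r s x * powLog r' s' x = powLog (r + r') (s + s') x := by
  have h := one_le_log_add_two hx
  unfold powLog
  rw [Real.rpow_add (by linarith), Real.rpow_add (by linarith)]
  ring

lemma powLog_pow (r s : ℝ) (n : ℕ) {x : ℝ} (hx : 1 ≤ x) :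
    powLog r s x ^ n = powLog (r * n) (s * n) x := by
  have h := one_le_log_add_two hx
  unfold powLog
  rw [mul_pow, Real.rpow_mul_natCast (by linarith), Real.rpow_mul_natCast (by linarith)]

lemma powLog_div (r s r' s' : ℝ) {x : ℝ} (hx : 1 ≤ x) :
    powLog r s x / powLog r' s' x = powLog (r - r') (s - s') x := by
  rw [div_eq_iff (powLog_pos _ _ hx).ne', powLog_mul _ _ _ _ hx, sub_add_cancel, sub_add_cancel]

lemma rpow_le_rpow_abs_mul {u v K : ℝ} (s : ℝ) (hu : 0 < u) (huv : u ≤ v) (hv : v ≤ K * u) :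
    u ^ s ≤ K ^ |s| * v ^ s := by
  have hK : 1 ≤ K := by
    by_contra! h
    nlinarith
  have hv0 : 0 < v := hu.trans_le huv
  rcases le_or_gt 0 s with hs | hs
  · have h1 : u ^ s ≤ v ^ s := Real.rpow_le_rpow hu.le huv hs
    have h2 : 1 ≤ K ^ |s| := Real.one_le_rpow hK (abs_nonneg s)
    nlinarith [Real.rpow_pos_of_pos hv0 s]
  · have h1 : (K * u) ^ s ≤ v ^ s := Real.rpow_le_rpow_of_nonpos hv0 hv hs.le
    rw [Real.mul_rpow (by linarith) hu.le] at h1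
    rw [abs_of_neg hs]
    have h2 : 0 < K ^ (-s) := by positivity
    have h3 : K ^ (-s) * K ^ s = 1 := by
      rw [← Real.rpow_add (by linarith)]; simp
    calc u ^ s = K ^ (-s) * (K ^ s * u ^ s) := by rw [← mul_assoc, h3, one_mul]
      _ ≤ _ := by gcongr

lemma log_add_two_le_mul {u v K : ℝ} (hu : 1 ≤ u) (huv : u ≤ v) (hv : v ≤ K * u) :
    Real.log (v + 2) ≤ (1 + Real.log K) * Real.log (u + 2) := by
  have hK : 1 ≤ K := by
    by_contra! h
    nlinarith
  have h1 := one_le_log_add_two hu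
  have h2 : Real.log (v + 2) ≤ Real.log (K * (u + 2)) :=
    Real.log_le_log (by linarith) (by nlinarith)
  rw [Real.log_mul (by linarith) (by linarith)] at h2
  nlinarith [Real.log_nonneg hK]

lemma exists_powLog_le_of_half_le (r s : ℝ) : ∃ C : ℝ, 0 ≤ C ∧ ∀ u v : ℝ, 1 ≤ u → u ≤ v →
    v ≤ 2 * u → powLog r s u ≤ C * powLog r s v := by
  refine ⟨2 ^ |r| * (1 + Real.log 2) ^ |s|, by positivity, fun u v hu huv hv ↦ ?_⟩
  have h := one_le_log_add_two hu
  have h1 := rpow_le_rpow_abs_mul r (by linarith) huv hv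
  have h2 := rpow_le_rpow_abs_mul s (by linarith) (Real.log_le_log (by linarith) (by linarith))
    (log_add_two_le_mul hu huv hv)
  unfold powLog
  calc _ ≤ (2 ^ |r| * v ^ r) * ((1 + Real.log 2) ^ |s| * Real.log (v + 2) ^ s) := by
        have : 0 ≤ v := by linarith
        gcongr
    _ = _ := by ring

lemma exists_powLog_le_of_lt (s s' : ℝ) {r r' : ℝ} (hr : r < r') : ∃ C : ℝ, 0 ≤ C ∧
    ∀ x : ℝ, 1 ≤ x → powLog r s x ≤ C * powLog r' s' x := by
  set t := |s - s'| with ht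
  have ht0 : 0 ≤ t := abs_nonneg _
  set ε := (r' - r) / (t + 1) with hε
  have hε0 : 0 < ε := div_pos (by linarith) (by linarith)
  have hεt : ε * t ≤ r' - r := by
    have : ε * (t + 1) = r' - r := by rw [hε]; field_simp
    nlinarith
  refine ⟨(3 ^ ε / ε) ^ t, by positivity, fun x hx ↦ ?_⟩
  have hl := one_le_log_add_two hx
  have h1 : Real.log (x + 2) ≤ 3 ^ ε / ε * x ^ ε :=
    calc Real.log (x + 2) ≤ (x + 2) ^ ε / ε := Real.log_le_rpow_div (by linarith) hε0
      _ ≤ (3 * x) ^ ε / ε := by gcongr; linarith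
      _ = _ := by rw [Real.mul_rpow (by norm_num) (by linarith)]; ring
  have h2 : Real.log (x + 2) ^ (s - s') ≤ (3 ^ ε / ε) ^ t * x ^ (r' - r) :=
    calc Real.log (x + 2) ^ (s - s') ≤ Real.log (x + 2) ^ t :=
          Real.rpow_le_rpow_of_exponent_le hl (le_abs_self _)
      _ ≤ (3 ^ ε / ε * x ^ ε) ^ t := Real.rpow_le_rpow (by linarith) h1 ht0
      _ = (3 ^ ε / ε) ^ t * x ^ (ε * t) := by
          rw [Real.mul_rpow (by positivity) (by positivity), ← Real.rpow_mul (by linarith)]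
      _ ≤ _ := by gcongr
  calc powLog r s x = powLog r s' x * Real.log (x + 2) ^ (s - s') := by
        unfold powLog
        rw [mul_assoc, ← Real.rpow_add (by linarith)]; congr 2; ring
    _ ≤ powLog r s' x * ((3 ^ ε / ε) ^ t * x ^ (r' - r)) :=
        mul_le_mul_of_nonneg_left h2 (powLog_pos _ _ hx).le
    _ = _ := by
        have : x ^ r' = x ^ r * x ^ (r' - r) := by
          rw [← Real.rpow_add (by linarith)]; congr 1; ring
        unfold powLog
        rw [this]; ring

lemma hasDerivAt_powLog (r s : ℝ) {x : ℝ} (hx : 1 ≤ x) :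
    HasDerivAt (powLog r s) (r * x ^ (r - 1) * Real.log (x + 2) ^ s +
      x ^ r * (1 / (x + 2) * s * Real.log (x + 2) ^ (s - 1))) x := by
  have hl := one_le_log_add_two hx
  have h1 : HasDerivAt (fun x : ℝ ↦ x ^ r) (r * x ^ (r - 1)) x :=
    Real.hasDerivAt_rpow_const (Or.inl (by linarith))
  have h2 : HasDerivAt (fun x : ℝ ↦ Real.log (x + 2)) (1 / (x + 2)) x :=
    ((hasDerivAt_id x).add_const 2).log (by simp; linarith)
  exact h1.mul (h2.rpow_const (Or.inl (by linarith)))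

lemma abs_deriv_powLog_le (r s : ℝ) {x : ℝ} (hx : 1 ≤ x) :
    |r * x ^ (r - 1) * Real.log (x + 2) ^ s +
      x ^ r * (1 / (x + 2) * s * Real.log (x + 2) ^ (s - 1))| ≤
      (|r| + |s|) * powLog (r - 1) s x := by
  have hl := one_le_log_add_two hx
  have hx0 : 0 < x := by linarith
  have h1 : x ^ r = x ^ (r - 1) * x := by
    rw [Real.rpow_sub_one hx0.ne']; field_simp
  have h2 : Real.log (x + 2) ^ (s - 1) ≤ Real.log (x + 2) ^ s :=
    Real.rpow_le_rpow_of_exponent_le hl (by linarith)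
  have h3 : x * (1 / (x + 2)) ≤ 1 := by
    rw [mul_one_div, div_le_one (by linarith)]; linarith
  have h4 : 0 < x ^ (r - 1) := by positivity
  have h5 : 0 < Real.log (x + 2) ^ (s - 1) := by positivity
  unfold powLog
  refine (abs_add_le _ _).trans ?_
  rw [add_mul]
  refine add_le_add (le_of_eq ?_) ?_
  · rw [abs_mul, abs_mul, abs_of_pos h4,
      abs_of_pos (show 0 < Real.log (x + 2) ^ s by positivity), mul_assoc]
  · rw [h1]
    calc _ = |s| * (x ^ (r - 1) * (x * (1 / (x + 2)) * Real.log (x + 2) ^ (s - 1))) := by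
          rw [abs_mul, abs_mul, abs_mul, abs_mul, abs_of_pos h4, abs_of_pos h5, abs_of_pos hx0,
            abs_of_pos (show 0 < 1 / (x + 2) by positivity)]
          ring
      _ ≤ |s| * (x ^ (r - 1) * (1 * Real.log (x + 2) ^ s)) := by gcongr
      _ = _ := by ring

lemma exists_abs_powLog_sub_le (r s : ℝ) : ∃ C : ℝ, 0 ≤ C ∧ ∀ y x : ℝ, 1 ≤ y → y ≤ x →
    x ≤ 2 * y → |powLog r s x - powLog r s y| ≤ C * powLog (r - 1) s x * (x - y) := by
  obtain ⟨C, hC0, hC⟩ := exists_powLog_le_of_half_le (r - 1) s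
  refine ⟨(|r| + |s|) * C, by positivity, fun y x hy hyx hxy ↦ ?_⟩
  have := (convex_Icc y x).norm_image_sub_le_of_norm_hasDerivWithin_le
    (f := powLog r s) (C := (|r| + |s|) * C * powLog (r - 1) s x)
    (fun z hz ↦ (hasDerivAt_powLog r s (hy.trans hz.1)).hasDerivWithinAt)
    (fun z hz ↦ ?_) (Set.left_mem_Icc.2 hyx) (Set.right_mem_Icc.2 hyx)
  · simpa [Real.norm_eq_abs, abs_of_nonneg (sub_nonneg.2 hyx)] using this
  · refine (abs_deriv_powLog_le r s (hy.trans hz.1)).trans ?_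
    rw [mul_assoc]
    gcongr
    exact hC z x (hy.trans hz.1) hz.2 (by linarith [hz.1])

lemma summable_rpow_mul_pow (t : ℝ) {q : ℝ} (hq0 : 0 < q) (hq : q < 1) :
    Summable (fun j : ℕ ↦ (1 + (j : ℝ)) ^ t * q ^ j) := by
  obtain ⟨N, hN⟩ := exists_nat_ge t
  have h1 : Summable (fun j : ℕ ↦ ((j : ℝ)) ^ N * q ^ j) :=
    summable_pow_mul_geometric_of_norm_lt_one N (by rwa [Real.norm_eq_abs, abs_of_pos hq0])
  have h2 := ((summable_nat_add_iff 1).2 h1).mul_left q⁻¹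
  refine h2.of_nonneg_of_le (fun j ↦ by positivity) (fun j ↦ ?_)
  have h3 : (1 + (j : ℝ)) ^ t ≤ (1 + (j : ℝ)) ^ N := by
    rw [← Real.rpow_natCast]
    exact Real.rpow_le_rpow_of_exponent_le (by simp) hN
  calc _ ≤ (1 + (j : ℝ)) ^ N * q ^ j := by gcongr
    _ = _ := by push_cast; rw [pow_succ]; field_simp; ring

lemma exists_sum_powLog_dyadic_le {p : ℝ} (q : ℝ) (hp : 0 < p) : ∃ C : ℝ, 0 ≤ C ∧
    ∀ (x : ℝ) (n : ℕ), 2 ^ n ≤ x →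
      ∑ j ∈ Finset.range (n + 1), powLog (p - 1) q (x / 2 ^ j) / 2 ^ j ≤
        C * powLog (p - 1) q x := by
  have hr0 : (0 : ℝ) < 2 ^ (-p) := by positivity
  have hr1 : (2 : ℝ) ^ (-p) < 1 := Real.rpow_lt_one_of_one_lt_of_neg (by norm_num) (by linarith)
  have hS := summable_rpow_mul_pow |q| hr0 hr1
  refine ⟨∑' j : ℕ, (1 + (j : ℝ)) ^ |q| * (2 ^ (-p)) ^ j, tsum_nonneg fun j ↦ by positivity,
    fun x n hx ↦ ?_⟩
  have hx1 : 1 ≤ x := (one_le_pow₀ (by norm_num : (1 : ℝ) ≤ 2)).trans hx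
  refine le_trans ?_ (mul_le_mul_of_nonneg_right
    (hS.sum_le_tsum (Finset.range (n + 1)) fun j _ ↦ by positivity) (powLog_pos _ _ hx1).le)
  rw [Finset.sum_mul]
  refine Finset.sum_le_sum fun j hj ↦ ?_
  have hj : j ≤ n := by simpa [Nat.lt_succ_iff] using hj
  have h2j : (0 : ℝ) < 2 ^ j := by positivity
  have h1 : 1 ≤ x / 2 ^ j := by
    rw [le_div_iff₀ h2j, one_mul]
    exact (pow_le_pow_right₀ (by norm_num) hj).trans hx
  have h2 : x / 2 ^ j ≤ x := div_le_self (by linarith) (one_le_pow₀ (by norm_num))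
  have hl := one_le_log_add_two h1
  have h3 := log_add_two_le_mul (K := 2 ^ j) h1 h2 (by field_simp; rfl)
  have h4 : Real.log (2 ^ j) ≤ j := by
    rw [Real.log_pow]
    nlinarith [Real.log_two_lt_d9, (Nat.cast_nonneg j : (0 : ℝ) ≤ j)]
  have h5 := rpow_le_rpow_abs_mul (K := 1 + j) q (by linarith)
    (Real.log_le_log (by linarith) (by linarith : x / 2 ^ j + 2 ≤ x + 2))
    (h3.trans (by gcongr))
  have h6 : (x / 2 ^ j) ^ (p - 1) / 2 ^ j = x ^ (p - 1) * (2 ^ (-p)) ^ j := by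
    rw [Real.div_rpow (by linarith) h2j.le, div_div, ← Real.rpow_add_one h2j.ne', sub_add_cancel,
      ← Real.rpow_natCast 2 j, ← Real.rpow_mul (by norm_num), ← Real.rpow_natCast (2 ^ (-p)) j,
      ← Real.rpow_mul (by norm_num), div_eq_mul_inv, ← Real.rpow_neg (by norm_num)]
    congr 2; ring
  unfold powLog
  calc _ = (x / 2 ^ j) ^ (p - 1) / 2 ^ j * Real.log (x / 2 ^ j + 2) ^ q := by ring
    _ ≤ (x / 2 ^ j) ^ (p - 1) / 2 ^ j * ((1 + j) ^ |q| * Real.log (x + 2) ^ q) := by gcongr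
    _ = _ := by rw [h6]; ring

lemma summable_powLog_of_lt {r : ℝ} (s : ℝ) (hr : r < -1) :
    Summable (fun n : ℕ ↦ powLog r s n) := by
  obtain ⟨C, -, hC⟩ := exists_powLog_le_of_lt s 0 (show r < (r - 1) / 2 by linarith)
  have h : Summable (fun n : ℕ ↦ C * (n : ℝ) ^ ((r - 1) / 2)) :=
    (Real.summable_nat_rpow.2 (by linarith)).mul_left C
  refine (summable_nat_add_iff 1).1
    (((summable_nat_add_iff 1).2 h).of_nonneg_of_le (fun n ↦ (powLog_pos _ _ ?_).le) fun n ↦ ?_)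
  · simp
  · simpa [powLog] using hC ((n + 1 : ℕ) : ℝ) (by simp)

lemma summable_powLog_neg_one {s : ℝ} (hs : s < -1) :
    Summable (fun n : ℕ ↦ powLog (-1) s n) := by
  have hlog (n : ℕ) : 0 < Real.log ((n : ℝ) + 2) :=
    Real.log_pos (by linarith [(Nat.cast_nonneg n : (0 : ℝ) ≤ n)])
  rw [← summable_condensed_iff_of_nonneg]
  · have h := ((summable_nat_add_iff 1).2 (Real.summable_nat_rpow.2 hs)).mul_left (Real.log 2 ^ s)
    refine (summable_nat_add_iff 1).1 (h.of_nonneg_of_le (fun k ↦ ?_) fun k ↦ ?_)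
    · have := powLog_pos (-1) s (x := ((2 ^ (k + 1) : ℕ) : ℝ))
        (by exact_mod_cast Nat.one_le_two_pow)
      positivity
    · have h2 : 0 < Real.log 2 := Real.log_pos (by norm_num)
      have h3 : Real.log 2 * ((k + 1 : ℕ) : ℝ) ≤ Real.log (((2 ^ (k + 1) : ℕ) : ℝ) + 2) := by
        rw [mul_comm, ← Real.log_pow]
        refine Real.log_le_log (by positivity) ?_
        push_cast
        linarith
      have h4 := Real.rpow_le_rpow_of_nonpos (by positivity) h3 (by linarith : s ≤ 0)
      rw [Real.mul_rpow h2.le (by positivity)] at h4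
      refine le_trans (le_of_eq ?_) h4
      unfold powLog
      rw [Real.rpow_neg_one, ← mul_assoc]
      push_cast
      rw [mul_inv_cancel₀ (by positivity), one_mul]
  · intro n
    have := hlog n
    unfold powLog
    positivity
  · intro m n hm hmn
    have := hlog m
    have hm' : (0 : ℝ) < m := by exact_mod_cast hm
    have hmn' : (m : ℝ) ≤ n := by exact_mod_cast hmn
    unfold powLog
    exact mul_le_mul (Real.rpow_le_rpow_of_nonpos hm' hmn' (by norm_num))
      (Real.rpow_le_rpow_of_nonpos this (Real.log_le_log (by linarith) (by linarith)) (by linarith))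
      (Real.rpow_nonneg (hlog n).le _) (by positivity)

lemma summable_powLog_two_pow {r : ℝ} (s : ℝ) (hr : r < 0) :
    Summable (fun k : ℕ ↦ powLog r s ((2 : ℝ) ^ k)) := by
  obtain ⟨C, -, hC⟩ := exists_powLog_le_of_lt s 0 (show r < r / 2 by linarith)
  have h1 (k : ℕ) : (1 : ℝ) ≤ 2 ^ k := one_le_pow₀ (by norm_num)
  have h : Summable (fun k : ℕ ↦ C * ((2 : ℝ) ^ (r / 2)) ^ k) :=
    (summable_geometric_of_lt_one (by positivity)
      (Real.rpow_lt_one_of_one_lt_of_neg (by norm_num) (by linarith))).mul_left C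
  refine h.of_nonneg_of_le (fun k ↦ (powLog_pos _ _ (h1 k)).le) fun k ↦ (hC _ (h1 k)).trans ?_
  unfold powLog
  rw [Real.rpow_zero, mul_one, ← Real.rpow_natCast, ← Real.rpow_natCast,
    ← Real.rpow_mul (by norm_num), ← Real.rpow_mul (by norm_num), mul_comm (k : ℝ)]

lemma muF_powLog (a b d : ℕ) (β γ B C : ℝ) {x : ℝ} (hx : 1 ≤ x) :
    muF a b d (powLog (-β) B) (powLog (-γ) C) x =
      max (powLog ((1 + β) * (a - b : ℕ)) (-B * (a - b : ℕ)) x)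
        (powLog ((1 + β) * (a - b : ℕ) + (β - γ) * (d - a : ℕ))
          (-B * (a - b : ℕ) + (C - B) * (d - a : ℕ)) x) := by
  have h1 : x = powLog 1 0 x := by simp [powLog]
  have h2 : x / powLog (-β) B x = powLog (1 + β) (-B) x := by
    nth_rw 1 [h1]
    rw [powLog_div _ _ _ _ hx]; congr 1 <;> ring
  rw [muF, if_neg (not_lt.2 hx), h2, powLog_div _ _ _ _ hx, powLog_pow _ _ _ hx,
    powLog_pow _ _ _ hx, mul_max_of_nonneg _ _ (powLog_pos _ _ hx).le, mul_one,
    powLog_mul _ _ _ _ hx, neg_sub_neg]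

lemma exists_abs_muF_sub_le {a b d : ℕ} (had : a < d) {β γ : ℝ} (B C : ℝ) (hγβ : γ < β) :
    ∃ K : ℝ, 0 ≤ K ∧ ∀ y x : ℝ, 1 ≤ y → y ≤ x → x ≤ 2 * y →
      |muF a b d (powLog (-β) B) (powLog (-γ) C) x -
        muF a b d (powLog (-β) B) (powLog (-γ) C) y| ≤
      K * powLog ((1 + β) * (a - b : ℕ) + (β - γ) * (d - a : ℕ) - 1)
          (-B * (a - b : ℕ) + (C - B) * (d - a : ℕ)) x * (x - y) := by
  have hm : (0 : ℝ) < (d - a : ℕ) := by exact_mod_cast Nat.sub_pos_of_lt had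
  set p₁ := (1 + β) * (a - b : ℕ)
  set q₁ := -B * (a - b : ℕ)
  set p := p₁ + (β - γ) * (d - a : ℕ) with hp
  set q := q₁ + (C - B) * (d - a : ℕ)
  obtain ⟨K₁, hK₁, h₁⟩ := exists_abs_powLog_sub_le p₁ q₁
  obtain ⟨K₂, hK₂, h₂⟩ := exists_abs_powLog_sub_le p q
  obtain ⟨K₃, hK₃, h₃⟩ := exists_powLog_le_of_lt q₁ q
    (show p₁ - 1 < p - 1 by rw [hp]; nlinarith)
  refine ⟨K₁ * K₃ + K₂, by positivity, fun y x hy hyx hxy ↦ ?_⟩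
  rw [muF_powLog _ _ _ _ _ _ _ (hy.trans hyx), muF_powLog _ _ _ _ _ _ _ hy]
  have hsub : 0 ≤ x - y := by linarith
  refine (abs_max_sub_max_le_max _ _ _ _).trans ((max_le_add_of_nonneg (abs_nonneg _)
    (abs_nonneg _)).trans ?_)
  calc _ ≤ K₁ * powLog (p₁ - 1) q₁ x * (x - y) + K₂ * powLog (p - 1) q x * (x - y) :=
        add_le_add (h₁ y x hy hyx hxy) (h₂ y x hy hyx hxy)
    _ ≤ K₁ * (K₃ * powLog (p - 1) q x) * (x - y) + K₂ * powLog (p - 1) q x * (x - y) := by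
        gcongr
        exact h₃ x (hy.trans hyx)
    _ = _ := by ring

lemma MF_eq_sum_range (a b d : ℕ) (ψ φ : ℝ → ℝ) {T n : ℕ} (h : Nat.log 2 T ≤ n) :
    MF a b d ψ φ T = ∑ j ∈ Finset.range (n + 1), muF a b d ψ φ ((T : ℝ) / 2 ^ j) := by
  refine Finset.sum_subset (Finset.range_mono (by omega)) fun j _ hj ↦ ?_
  have hT : T < 2 ^ j := Nat.lt_pow_of_log_lt (by norm_num) (by simpa using hj)
  rw [muF, if_pos]
  rw [div_lt_one (by positivity)]
  exact_mod_cast hT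

lemma exists_abs_lamF_le {a b d : ℕ} (had : a < d) {β γ : ℝ} (B C : ℝ) (hβ : 0 < β)
    (hγβ : γ < β) :
    ∃ K J : ℝ, 0 ≤ K ∧ 0 ≤ J ∧ ∀ T : ℕ, 1 ≤ T →
      |lamF a b d (powLog (-β) B) (powLog (-γ) C) T| ≤
      K * powLog ((1 + β) * (a - b : ℕ) + (β - γ) * (d - a : ℕ) - 1)
          (-B * (a - b : ℕ) + (C - B) * (d - a : ℕ)) T +
        if T = 2 ^ Nat.log 2 T then J else 0 := by
  obtain ⟨K, hK, h⟩ := exists_abs_muF_sub_le (b := b) had B C hγβ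
  have hm : (0 : ℝ) < (d - a : ℕ) := by exact_mod_cast Nat.sub_pos_of_lt had
  set p := (1 + β) * (a - b : ℕ) + (β - γ) * (d - a : ℕ) with hp
  set q := -B * (a - b : ℕ) + (C - B) * (d - a : ℕ)
  set μ := muF a b d (powLog (-β) B) (powLog (-γ) C) with hμ
  have hp0 : 0 < p := by
    have : 0 < (β - γ) * (d - a : ℕ) := mul_pos (by linarith) hm
    positivity
  obtain ⟨S, hS, hsum⟩ := exists_sum_powLog_dyadic_le q hp0
  refine ⟨K * S, |μ 1|, by positivity, abs_nonneg _, fun T hT ↦ ?_⟩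
  have hn : 2 ^ Nat.log 2 T ≤ T := Nat.pow_log_le_self 2 (by omega)
  rw [lamF, MF_eq_sum_range _ _ _ _ _ le_rfl,
    MF_eq_sum_range _ _ _ _ _ (Nat.log_mono_right (Nat.sub_le T 1)), ← Finset.sum_sub_distrib]
  have hterm : ∀ j ∈ Finset.range (Nat.log 2 T + 1),
      |μ ((T : ℝ) / 2 ^ j) - μ (((T - 1 : ℕ) : ℝ) / 2 ^ j)| ≤
        K * (powLog (p - 1) q ((T : ℝ) / 2 ^ j) / 2 ^ j) +
          if Nat.log 2 T = j then (if T = 2 ^ Nat.log 2 T then |μ 1| else 0) else 0 := by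
    intro j hj
    have hj : j ≤ Nat.log 2 T := by simpa [Nat.lt_succ_iff] using hj
    have hjT : 2 ^ j ≤ T := (Nat.pow_le_pow_right (by norm_num) hj).trans hn
    have h2j : (0 : ℝ) < 2 ^ j := by positivity
    have hx : 1 ≤ (T : ℝ) / 2 ^ j := by
      rw [one_le_div h2j]; exact_mod_cast hjT
    have hg := powLog_pos (p - 1) q hx
    rcases Nat.lt_or_ge (T - 1) (2 ^ j) with hlt | hge
    · have hTj : T = 2 ^ j := by omega
      have hlog : Nat.log 2 T = j := by rw [hTj, Nat.log_pow (by norm_num)]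
      have h0 : μ (((T - 1 : ℕ) : ℝ) / 2 ^ j) = 0 := by
        rw [hμ, muF, if_pos]
        rw [div_lt_one h2j]; exact_mod_cast hlt
      have h1 : (T : ℝ) / 2 ^ j = 1 := by
        rw [hTj]; push_cast; exact div_self h2j.ne'
      rw [if_pos hlog, hlog, if_pos hTj, h0, sub_zero, h1]
      rw [h1] at hg
      exact le_add_of_nonneg_left (by positivity)
    · have hT2 : 2 ≤ T := by have := Nat.one_le_two_pow (n := j); omega
      have hc : ((T - 1 : ℕ) : ℝ) = T - 1 := by push_cast [hT]; rfl
      have hT2' : (2 : ℝ) ≤ T := by exact_mod_cast hT2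
      have hy : 1 ≤ ((T - 1 : ℕ) : ℝ) / 2 ^ j := by
        rw [one_le_div h2j]; exact_mod_cast hge
      refine (h _ _ hy (by gcongr; omega) ?_).trans ?_
      · rw [hc, ← mul_div_assoc]; gcongr; linarith
      · rw [hc, ← sub_div, sub_sub_cancel]
        refine le_add_of_le_of_nonneg (le_of_eq (by ring)) ?_
        split_ifs <;> positivity
  calc _ ≤ _ := Finset.abs_sum_le_sum_abs _ _
    _ ≤ _ := Finset.sum_le_sum hterm
    _ ≤ _ := by
      rw [Finset.sum_add_distrib, Finset.sum_ite_eq, if_pos (by simp), ← Finset.mul_sum, mul_assoc]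
      gcongr
      exact hsum T _ (by exact_mod_cast hn)

lemma summable_ite_two_pow_mul {f : ℕ → ℝ} (J : ℝ) (hf : Summable fun k : ℕ ↦ f (2 ^ k)) :
    Summable fun T : ℕ ↦ (if T = 2 ^ Nat.log 2 T then J else 0) * f T := by
  rw [← (Nat.pow_right_injective le_rfl : Function.Injective fun k : ℕ ↦ 2 ^ k).summable_iff]
  · refine (hf.mul_left J).congr fun k ↦ ?_
    simp [Nat.log_pow]
  · intro T hT
    rw [if_neg fun h ↦ hT ⟨_, h.symm⟩, zero_mul]

/-- for `1 ≤ c < b ≤ a < d`, `0 < γ < β`, `ψ(T) = T^{−β} log(T+2)^{B₀}` and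
`φ(T) = T^{−γ} log(T+2)^{C₀}`, if `γ(d−c) > β(d−b)+c−b`, or `γ(d−c) = β(d−b)+c−b` and
`C₀(d−c) − B₀(d−b) < −1`, then the series `Σ_T λ_T φ(T)^{a−c}/T^{a−c}` converges. -/
theorem stmt_9 (a b c d : ℕ) (hc : 1 ≤ c) (hcb : c < b) (hba : b ≤ a) (had : a < d)
    (β γ B₀ C₀ : ℝ) (hγpos : 0 < γ) (hγβ : γ < β)
    (hcond :
      γ * ((d : ℝ) - (c : ℝ)) > β * ((d : ℝ) - (b : ℝ)) + (c : ℝ) - (b : ℝ) ∨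
      (γ * ((d : ℝ) - (c : ℝ)) = β * ((d : ℝ) - (b : ℝ)) + (c : ℝ) - (b : ℝ) ∧
        C₀ * ((d : ℝ) - (c : ℝ)) - B₀ * ((d : ℝ) - (b : ℝ)) < -1)) :
    Summable (fun T : ℕ =>
      lamF a b d (fun t => t ^ (-β) * Real.log (t + 2) ^ B₀)
          (fun t => t ^ (-γ) * Real.log (t + 2) ^ C₀) T *
        ((T : ℝ) ^ (-γ) * Real.log ((T : ℝ) + 2) ^ C₀) ^ (a - c) / (T : ℝ) ^ (a - c)) := by
  have hn : (0 : ℝ) < (a - c : ℕ) := by exact_mod_cast Nat.sub_pos_of_lt (hcb.trans_le hba)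
  obtain ⟨K, J, hK, -, hlam⟩ := exists_abs_lamF_le (b := b) had B₀ C₀ (hγpos.trans hγβ) hγβ
  set p := (1 + β) * (a - b : ℕ) + (β - γ) * (d - a : ℕ) with hp
  set q := -B₀ * (a - b : ℕ) + (C₀ - B₀) * (d - a : ℕ) with hq
  set r := -(1 + γ) * (a - c : ℕ) with hr
  set s := C₀ * (a - c : ℕ) with hs
  have hw (T : ℕ) (hT : 1 ≤ T) :
      powLog (-γ) C₀ (T : ℝ) ^ (a - c) / (T : ℝ) ^ (a - c) = powLog r s T := by
    have hT' : (1 : ℝ) ≤ T := by exact_mod_cast hT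
    have h1 : (T : ℝ) = powLog 1 0 T := by simp [powLog]
    rw [← div_pow]
    nth_rw 2 [h1]
    rw [powLog_div _ _ _ _ hT', powLog_pow _ _ _ hT']
    congr 1 <;> ring
  have hab : ((a - b : ℕ) : ℝ) = a - b := Nat.cast_sub hba
  have hda : ((d - a : ℕ) : ℝ) = d - a := Nat.cast_sub had.le
  have hac : ((a - c : ℕ) : ℝ) = a - c := Nat.cast_sub (hcb.le.trans hba)
  have hpr : p + r = β * (d - b) + c - b - γ * (d - c) := by
    rw [hp, hr, hab, hda, hac]; ring
  have hqs : q + s = C₀ * (d - c) - B₀ * (d - b) := by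
    rw [hq, hs, hab, hda, hac]; ring
  have hmain : Summable fun T : ℕ ↦ powLog (p - 1 + r) (q + s) T := by
    rcases hcond with h | ⟨h, h'⟩
    · exact summable_powLog_of_lt _ (by linarith)
    · rw [show p - 1 + r = -1 by linarith]
      exact summable_powLog_neg_one (by linarith)
  have hjump : Summable fun T : ℕ ↦
      (if T = 2 ^ Nat.log 2 T then J else 0) * powLog r s (T : ℝ) := by
    refine summable_ite_two_pow_mul J ?_
    push_cast
    exact summable_powLog_two_pow s (by rw [hr]; nlinarith)
  refine Summable.of_norm_bounded ((hmain.mul_left K).add hjump) fun T ↦ ?_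
  change ‖lamF a b d (powLog (-β) B₀) (powLog (-γ) C₀) T * powLog (-γ) C₀ (T : ℝ) ^ (a - c) /
    (T : ℝ) ^ (a - c)‖ ≤ _
  rcases Nat.eq_zero_or_pos T with rfl | hT
  · have h : 0 ≤ powLog (p - 1 + r) (q + s) 0 := by
      have := Real.log_nonneg (show (1 : ℝ) ≤ 0 + 2 by norm_num)
      unfold powLog
      positivity
    simpa [lamF] using mul_nonneg hK h
  · have hT' : (1 : ℝ) ≤ T := by exact_mod_cast hT
    have hpos := powLog_pos r s hT'
    rw [mul_div_assoc, hw T hT, norm_mul, Real.norm_eq_abs, Real.norm_eq_abs, abs_of_pos hpos,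
      ← powLog_mul _ _ _ _ hT', ← mul_assoc, ← add_mul]
    exact mul_le_mul_of_nonneg_right (hlam T hT) hpos.le

end
end
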